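/- arXiv:1806.06023 — 4 statements merged into one kernel-verified Lean document; each statement's English description precedes it below -/
import Mathlib

section
/- Determinant expression for the related numbers of higher order Appell polynomials: let f(t) = Σ_{n≥0} d_n t^n/n! be a formal power series over ℂ with d_0 = 1, let r ≥ 1 be an integer, and define the numbers a_n^{(r)} by 1/f(t)^r = Σ_{n≥0} a_n^{(r)} t^n/n!. For e ≥ 0 set D_r(e) = Σ_{i_1+⋯+i_r = e, i_1,…,i_r ≥ 0} (d_{i_1} ⋯ d_{i_r})/(i_1! ⋯ i_r!) (equivalently, D_r(e) is the e-th coefficient of f(t)^r). Then for every n ≥ 1, a_n^{(r)} = (−1)^n · n! · det M, where M is the n×n matrix whose (i,j) entry (1 ≤ i, j ≤ n) is D_r(i−j+1) if i ≥ j, is 1 if j = i+1, and is 0 if j > i+1. -/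
/-- A sum over tuples of length `k + 1` splits off the first entry. -/
theorem Finset.Nat.sum_antidiagonalTuple_succ {M : Type*} [AddCommMonoid M] (k n : ℕ)
    (g : (Fin (k + 1) → ℕ) → M) :
    ∑ x ∈ Finset.Nat.antidiagonalTuple (k + 1) n, g x =
      ∑ p ∈ Finset.HasAntidiagonal.antidiagonal n, ∑ x ∈ Finset.Nat.antidiagonalTuple k p.2,
        g (Fin.cons p.1 x) := by
  rw [Finset.sum_sigma']
  refine Finset.sum_bij' (fun x _ => ⟨(x 0, ∑ j, Fin.tail x j), Fin.tail x⟩)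
    (fun y _ => Fin.cons y.1.1 y.2) ?_ ?_ ?_ ?_ ?_
  · intro x hx
    simpa [Finset.Nat.mem_antidiagonalTuple, Fin.sum_univ_succ, Fin.tail] using hx
  · rintro ⟨⟨p, q⟩, x⟩ hy
    simp only [Finset.mem_sigma, Finset.HasAntidiagonal.mem_antidiagonal,
      Finset.Nat.mem_antidiagonalTuple] at hy
    simp [Finset.Nat.mem_antidiagonalTuple, Fin.sum_cons, hy.1, hy.2]
  · intro x _
    simp
  · rintro ⟨⟨p, q⟩, x⟩ hy
    simp only [Finset.mem_sigma, Finset.Nat.mem_antidiagonalTuple] at hy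
    simp [hy.2]
  · intro x _
    simp

/-- The coefficients of a power of a power series, as a sum over tuples. -/
theorem PowerSeries.coeff_pow_eq_sum_antidiagonalTuple {R : Type*} [CommSemiring R]
    (c : ℕ → R) (r e : ℕ) :
    PowerSeries.coeff e (PowerSeries.mk c ^ r) =
      ∑ i ∈ Finset.Nat.antidiagonalTuple r e, ∏ j, c (i j) := by
  induction r generalizing e with
  | zero => cases e <;> simp [PowerSeries.coeff_one]
  | succ r ih =>
    rw [pow_succ', PowerSeries.coeff_mul, Finset.Nat.sum_antidiagonalTuple_succ]
    simp [ih, Fin.prod_univ_succ, Finset.mul_sum]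

/-- Wronski's formula: the coefficients of the inverse of a power series with constant
coefficient `1`, as determinants of Hessenberg matrices. -/
theorem PowerSeries.coeff_eq_det_of_mul_eq_one {R : Type*} [CommRing R] {F G : PowerSeries R}
    (h : F * G = 1) (h0 : PowerSeries.coeff 0 F = 1) (n : ℕ) :
    PowerSeries.coeff n G = (-1) ^ n * Matrix.det (Matrix.of fun i j : Fin n =>
      if (j : ℕ) ≤ (i : ℕ) then PowerSeries.coeff ((i : ℕ) - (j : ℕ) + 1) F
      else if (j : ℕ) = (i : ℕ) + 1 then 1
      else 0) := by
  let N : Matrix (Fin (n + 1)) (Fin (n + 1)) R := Matrix.of fun i j =>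
    if (j : ℕ) ≤ (i : ℕ) then PowerSeries.coeff ((i : ℕ) - (j : ℕ)) F else 0
  let b : Fin (n + 1) → R := fun i => PowerSeries.coeff (i : ℕ) G
  have hdet : N.det = 1 := by
    rw [Matrix.det_of_isLowerTriangular N]
    · simp [N, h0, -PowerSeries.coeff_zero_eq_constantCoeff]
    · intro i j hij
      have hlt : (i : ℕ) < j := hij
      exact if_neg hlt.not_ge
  have hb : N.mulVec b = Pi.single 0 1 := by
    ext i
    have hi := congrArg (PowerSeries.coeff (i : ℕ)) h
    rw [mul_comm, PowerSeries.coeff_mul, Finset.Nat.sum_antidiagonal_eq_sum_range_succ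
      (fun k l => PowerSeries.coeff k G * PowerSeries.coeff l F), PowerSeries.coeff_one] at hi
    have hs : N.mulVec b i = ∑ k ∈ Finset.range (n + 1), if k ≤ (i : ℕ) then
        PowerSeries.coeff k G * PowerSeries.coeff ((i : ℕ) - k) F else 0 := by
      rw [← Fin.sum_univ_eq_sum_range (fun k => if k ≤ (i : ℕ) then
        PowerSeries.coeff k G * PowerSeries.coeff ((i : ℕ) - k) F else 0)]
      simp [Matrix.mulVec, dotProduct, N, b, mul_comm]
    have hr : (Finset.range (n + 1)).filter (fun k => k ≤ (i : ℕ)) =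
        Finset.range ((i : ℕ) + 1) := by
      ext k
      have := i.isLt
      simp only [Finset.mem_filter, Finset.mem_range]
      omega
    rw [hs, ← Finset.sum_filter, hr, hi]
    simp [Pi.single_apply]
  have key : N.adjugate.mulVec (N.mulVec b) = b := by
    rw [Matrix.mulVec_mulVec, Matrix.adjugate_mul, hdet, one_smul, Matrix.one_mulVec]
  have hlast := congrFun key (Fin.last n)
  rw [hb, Matrix.mulVec_single_one, Matrix.col_apply,
    Matrix.adjugate_fin_succ_eq_det_submatrix] at hlast
  simp only [b, Fin.val_last, Fin.val_zero, zero_add] at hlast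
  rw [← hlast]
  congr 2
  ext i j
  simp only [N, Matrix.submatrix_apply, Matrix.of_apply, Fin.succAbove_last,
    Fin.succAbove_zero, Fin.val_castSucc, Fin.val_succ]
  rcases lt_trichotomy (j : ℕ) ((i : ℕ) + 1) with hij | hij | hij
  · rw [if_pos hij.le, if_pos (by omega), show (i : ℕ) + 1 - j = i - j + 1 by omega]
  · rw [if_pos hij.le, if_neg (by omega), if_pos hij, hij, Nat.sub_self, h0]
  · rw [if_neg (by omega), if_neg (by omega), if_neg (by omega)]

/-- Determinant expression for the related numbers of higher order Appell polynomials. -/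
theorem appell_det (d : ℕ → ℂ) (hd : d 0 = 1) (r : ℕ) (hr : 1 ≤ r)
    (a : ℕ → ℂ)
    (ha : ((PowerSeries.mk fun n => d n / (n.factorial : ℂ)) ^ r)⁻¹ =
      PowerSeries.mk fun n => a n / (n.factorial : ℂ))
    (D : ℕ → ℂ)
    (hD : ∀ e, D e =
      ∑ i ∈ Finset.Nat.antidiagonalTuple r e, ∏ j, d (i j) / ((i j).factorial : ℂ))
    (n : ℕ) (hn : 1 ≤ n) :
    a n = (-1 : ℂ) ^ n * (n.factorial : ℂ) *
      Matrix.det (Matrix.of fun i j : Fin n =>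
        if (j : ℕ) ≤ (i : ℕ) then D ((i : ℕ) - (j : ℕ) + 1)
        else if (j : ℕ) = (i : ℕ) + 1 then 1
        else 0) := by
  have h0 : PowerSeries.constantCoeff
      ((PowerSeries.mk fun n => d n / (n.factorial : ℂ)) ^ r) = 1 := by
    rw [map_pow, ← PowerSeries.coeff_zero_eq_constantCoeff_apply, PowerSeries.coeff_mk]
    simp [hd]
  have hinv := PowerSeries.mul_inv_cancel _ (h0 ▸ one_ne_zero)
  have hdet := PowerSeries.coeff_eq_det_of_mul_eq_one hinv
    (by rw [PowerSeries.coeff_zero_eq_constantCoeff_apply, h0]) n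
  rw [ha, PowerSeries.coeff_mk, div_eq_iff (by exact_mod_cast n.factorial_ne_zero)] at hdet
  simp only [PowerSeries.coeff_pow_eq_sum_antidiagonalTuple, ← hD] at hdet
  rw [hdet]
  ring
end

section
/- Determinant expression for the generalized hypergeometric Bernoulli numbers: let M, N be positive integers and define the generalized hypergeometric Bernoulli numbers B_{M,N,n} by 1/₁F₁(M; M+N; t) = Σ_{n≥0} B_{M,N,n} t^n/n!, where ₁F₁(M; M+N; t) = Σ_{n≥0} ((M)^{(n)}/(M+N)^{(n)}) t^n/n! and (x)^{(n)} = x(x+1)⋯(x+n−1) is the rising factorial. Then for every n ≥ 1, B_{M,N,n} = (−1)^n · n! · det A, where A is the n×n matrix whose (i,j) entry (1 ≤ i, j ≤ n) is (M)^{(i−j+1)} / ((i−j+1)! · (M+N)^{(i−j+1)}) if i ≥ j, is 1 if j = i+1, and is 0 if j > i+1. -/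
/-- The rising factorial `(x)^{(n)} = x (x+1) ⋯ (x+n-1)`, with `(x)^{(0)} = 1`. -/
def risingFactorial (x n : ℕ) : ℕ := ∏ i ∈ Finset.range n, (x + i)

/-- The lower triangular Toeplitz matrix of size `n` built from the coefficients of a power series. -/
noncomputable def PowerSeries.toeplitz {R : Type*} [CommRing R] (f : PowerSeries R) (n : ℕ) :
    Matrix (Fin n) (Fin n) R :=
  Matrix.of fun i j => if (j : ℕ) ≤ (i : ℕ) then PowerSeries.coeff ((i : ℕ) - (j : ℕ)) f else 0

theorem PowerSeries.det_toeplitz {R : Type*} [CommRing R] (f : PowerSeries R) (n : ℕ) :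
    (f.toeplitz n).det = PowerSeries.constantCoeff f ^ n := by
  rw [Matrix.det_of_isLowerTriangular]
  · simp [toeplitz]
  · intro i j hij
    have : (i : ℕ) < j := hij
    simp [toeplitz, this.not_ge, -Fin.val_fin_le]

theorem PowerSeries.toeplitz_mulVec_coeff {R : Type*} [CommRing R] (f g : PowerSeries R) (n : ℕ) :
    (f.toeplitz n).mulVec (fun j => PowerSeries.coeff (j : ℕ) g) =
      fun i : Fin n => PowerSeries.coeff (i : ℕ) (f * g) := by
  ext i
  rw [mul_comm f g, PowerSeries.coeff_mul,
    Finset.Nat.sum_antidiagonal_eq_sum_range_succ_mk]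
  simp only [Matrix.mulVec, dotProduct, toeplitz, Matrix.of_apply, ite_mul, zero_mul]
  rw [Fin.sum_univ_eq_sum_range (fun j : ℕ => if j ≤ (i : ℕ) then
    PowerSeries.coeff ((i : ℕ) - j) f * PowerSeries.coeff j g else 0), ← Finset.sum_filter]
  refine Finset.sum_congr ?_ fun j _ => mul_comm _ _
  ext j
  have := i.isLt
  simp only [Finset.mem_filter, Finset.mem_range]
  omega

/-- The coefficients of the inverse of a power series with constant coefficient `1`, as
determinants of a lower Hessenberg minor of its Toeplitz matrix. -/
theorem PowerSeries.coeff_eq_det_of_mul_eq_one_s8 {R : Type*} [CommRing R] {f g : PowerSeries R}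
    (hf : PowerSeries.constantCoeff f = 1) (hfg : f * g = 1) (n : ℕ) :
    PowerSeries.coeff n g =
      (-1) ^ n * ((f.toeplitz (n + 1)).submatrix Fin.succ Fin.castSucc).det := by
  have hcol : (f.toeplitz (n + 1)).mulVec (fun j => PowerSeries.coeff (j : ℕ) g) =
      Pi.single 0 1 := by
    rw [toeplitz_mulVec_coeff, hfg]
    ext i
    simp [PowerSeries.coeff_one, Pi.single_apply]
  have hadj := congrArg ((f.toeplitz (n + 1)).adjugate.mulVec) hcol
  rw [Matrix.mulVec_mulVec, Matrix.adjugate_mul, det_toeplitz, hf, one_pow, one_smul,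
    Matrix.one_mulVec, Matrix.mulVec_single_one] at hadj
  simpa [Matrix.adjugate_fin_succ_eq_det_submatrix, Fin.succAbove_last, Fin.succAbove_zero]
    using congrFun hadj (Fin.last n)

/-- Determinant expression for the generalized hypergeometric Bernoulli numbers,
defined by `1/₁F₁(M; M+N; t) = Σ_{n≥0} B_{M,N,n} t^n/n!`. -/
theorem hypergeometric_bernoulli_det (M N : ℕ) (hM : 1 ≤ M) (hN : 1 ≤ N)
    (B : ℕ → ℚ)
    (hB : (PowerSeries.mk fun n =>
        (risingFactorial M n : ℚ) / ((risingFactorial (M + N) n : ℚ) * (n.factorial : ℚ)))⁻¹ =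
      PowerSeries.mk fun n => B n / (n.factorial : ℚ))
    (n : ℕ) (hn : 1 ≤ n) :
    B n = (-1 : ℚ) ^ n * (n.factorial : ℚ) *
      Matrix.det (Matrix.of fun i j : Fin n =>
        if (j : ℕ) ≤ (i : ℕ) then
          (risingFactorial M ((i : ℕ) - (j : ℕ) + 1) : ℚ) /
            ((((i : ℕ) - (j : ℕ) + 1).factorial : ℚ) *
              (risingFactorial (M + N) ((i : ℕ) - (j : ℕ) + 1) : ℚ))
        else if (j : ℕ) = (i : ℕ) + 1 then 1
        else 0) := by
  have hconst : PowerSeries.constantCoeff (PowerSeries.mk fun n =>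
      (risingFactorial M n : ℚ) / ((risingFactorial (M + N) n : ℚ) * (n.factorial : ℚ))) = 1 := by
    simp [← PowerSeries.coeff_zero_eq_constantCoeff_apply, risingFactorial]
  have hcoeff := PowerSeries.coeff_eq_det_of_mul_eq_one_s8 hconst
    (PowerSeries.mul_inv_cancel _ (by rw [hconst]; exact one_ne_zero)) n
  rw [hB, PowerSeries.coeff_mk, div_eq_iff (by positivity)] at hcoeff
  rw [hcoeff, mul_right_comm]
  congr 2
  ext i j
  simp only [PowerSeries.toeplitz, Matrix.submatrix_apply, Matrix.of_apply, Fin.val_succ,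
    Fin.val_castSucc, PowerSeries.coeff_mk]
  rcases lt_trichotomy (j : ℕ) (i + 1) with h | h | h
  · rw [if_pos h.le, if_pos (Nat.lt_succ_iff.mp h), Nat.sub_add_comm (Nat.lt_succ_iff.mp h),
      mul_comm (risingFactorial (M + N) _ : ℚ)]
  · simp [h, risingFactorial]
  · rw [if_neg (by omega), if_neg (by omega), if_neg (by omega)]
end

section
/- Glaisher's determinant expression for the Bernoulli numbers: let B_n denote the Bernoulli numbers, defined by t/(e^t − 1) = Σ_{n≥0} B_n t^n/n! (so B_1 = −1/2). Then for every n ≥ 1, B_n = (−1)^n · n! · det G, where G is the n×n matrix whose (i,j) entry (1 ≤ i, j ≤ n) is 1/(i−j+2)! if i ≥ j, is 1 if j = i+1, and is 0 if j > i+1. -/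
/-- If `∑ i ∈ range (m + 1), a (m - i) * b i` is `1` for `m = 0` and `0` otherwise, and `a 0 = 1`,
then `b n` is up to sign the determinant of the Hessenberg matrix with entries `a (i + 1 - j)`. -/
theorem eq_neg_one_pow_mul_det_of_convolution_eq_one {R : Type*} [CommRing R] {a b : ℕ → R}
    (ha : a 0 = 1)
    (hab : ∀ m, ∑ i ∈ Finset.range (m + 1), a (m - i) * b i = if m = 0 then 1 else 0) (n : ℕ) :
    b n = (-1) ^ n * Matrix.det (Matrix.of fun i j : Fin n =>
      if (j : ℕ) ≤ (i : ℕ) + 1 then a ((i : ℕ) + 1 - (j : ℕ)) else 0) := by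
  set T : Matrix (Fin (n + 1)) (Fin (n + 1)) R := Matrix.of fun i j =>
    if (j : ℕ) ≤ (i : ℕ) then a ((i : ℕ) - (j : ℕ)) else 0 with hT
  have hdet : T.det = 1 := by
    rw [Matrix.det_of_isLowerTriangular]
    · simp [hT, ha]
    · intro i j hij
      have hij' : i < j := hij
      simp [hT, hij']
  have hmul : T.mulVec (fun i => b i) = Pi.single 0 1 := by
    ext i
    have hrange : Finset.range ((i : ℕ) + 1) =
        (Finset.range (n + 1)).filter fun j => j ≤ (i : ℕ) := by
      ext j
      simp only [Finset.mem_range, Finset.mem_filter]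
      omega
    have h := hab i
    rw [hrange, Finset.sum_filter, Finset.sum_range] at h
    simpa [hT, Matrix.mulVec, dotProduct, Pi.single_apply, ite_mul] using h
  have hadj : T.adjugate (Fin.last n) 0 = b n := by
    have h := congrArg (fun v => T.adjugate.mulVec v (Fin.last n)) hmul
    simpa [Matrix.mulVec_mulVec, Matrix.adjugate_mul, hdet, eq_comm] using h
  rw [← hadj, Matrix.adjugate_fin_succ_eq_det_submatrix]
  simp only [Fin.val_last, Fin.val_zero, zero_add]
  congr 2
  ext i j
  simp only [hT, Matrix.submatrix_apply, Matrix.of_apply, Fin.succAbove_zero, Fin.succAbove_last,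
    Fin.val_succ, Fin.val_castSucc]

/-- The convolution form of the defining recursion of the Bernoulli numbers. -/
theorem sum_inv_factorial_mul_bernoulli_div_factorial (m : ℕ) :
    ∑ i ∈ Finset.range (m + 1),
      (1 : ℚ) / ((m - i + 1).factorial : ℚ) * (bernoulli i / (i.factorial : ℚ)) =
        if m = 0 then 1 else 0 := by
  have h := sum_bernoulli (m + 1)
  have hm : ((m + 1).factorial : ℚ) ≠ 0 := by positivity
  rw [← mul_right_inj' hm, Finset.mul_sum]
  convert h using 1
  · refine Finset.sum_congr rfl fun i hi => ?_
    have hi' : i ≤ m := Nat.lt_succ_iff.mp (Finset.mem_range.mp hi)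
    rw [Nat.cast_choose ℚ (by omega : i ≤ m + 1), Nat.sub_add_comm hi']
    field_simp
  · by_cases hm0 : m = 0 <;> simp [hm0]


/-- Glaisher's determinant expression for the Bernoulli numbers
(with the convention `B₁ = -1/2`, i.e. `t/(e^t - 1) = Σ Bₙ tⁿ/n!`). -/
theorem glaisher_bernoulli_det (n : ℕ) (hn : 1 ≤ n) :
    bernoulli n = (-1 : ℚ) ^ n * (n.factorial : ℚ) *
      Matrix.det (Matrix.of fun i j : Fin n =>
        if (j : ℕ) ≤ (i : ℕ) then
          (1 : ℚ) / ((((i : ℕ) - (j : ℕ) + 2).factorial : ℚ))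
        else if (j : ℕ) = (i : ℕ) + 1 then 1
        else 0) := by
  have h := eq_neg_one_pow_mul_det_of_convolution_eq_one
    (a := fun k => (1 : ℚ) / ((k + 1).factorial : ℚ))
    (b := fun k => bernoulli k / (k.factorial : ℚ)) (by simp)
    sum_inv_factorial_mul_bernoulli_div_factorial n
  rw [div_eq_iff (by positivity), mul_right_comm] at h
  rw [h]
  congr 2
  ext i j
  simp only [Matrix.of_apply]
  rcases lt_trichotomy (j : ℕ) ((i : ℕ) + 1) with hij | hij | hij
  · have hij' : (j : ℕ) ≤ i := by omega
    rw [if_pos hij.le, if_pos hij', Nat.sub_add_comm hij']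
  · simp [hij]
  · rw [if_neg (by omega), if_neg (by omega), if_neg (by omega)]
end

section
/- Determinant expression for the generalized hypergeometric Cauchy numbers: let M, N be positive integers and define the generalized hypergeometric Cauchy numbers c_{M,N,n} by 1/₂F₁(M, N; N+1; −t) = Σ_{n≥0} c_{M,N,n} t^n/n!, where ₂F₁(M, N; N+1; −t) = Σ_{n≥0} ((M)^{(n)}(N)^{(n)}/(N+1)^{(n)}) (−t)^n/n! and (x)^{(n)} = x(x+1)⋯(x+n−1) is the rising factorial. Then for every n ≥ 1, c_{M,N,n} = n! · det C, where C is the n×n matrix whose (i,j) entry (1 ≤ i, j ≤ n) is (M)^{(i−j+1)} · N / ((i−j+1)! · (N+i−j+1)) if i ≥ j, is 1 if j = i+1, and is 0 if j > i+1. -/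
open Matrix PowerSeries in
/-- **Wronski's formula**: the coefficients of the inverse of a power series with constant
coefficient `1` are, up to sign, Toeplitz-Hessenberg determinants. -/
theorem PowerSeries.det_coeff_hessenberg {R : Type*} [CommRing R] {f g : R⟦X⟧}
    (hf : coeff 0 f = 1) (hfg : f * g = 1) (n : ℕ) :
    det (of fun i j : Fin n =>
      if (j : ℕ) ≤ i + 1 then coeff (i + 1 - j : ℕ) f else 0) = (-1) ^ n * coeff n g := by
  have hg : coeff 0 g = 1 := by
    have h := congrArg (coeff 0) hfg
    simp only [coeff_zero_eq_constantCoeff, map_mul, map_one] at h hf ⊢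
    simpa [hf] using h
  cases n with
  | zero => simp [-coeff_zero_eq_constantCoeff, hg]
  | succ m =>
    set A : Matrix (Fin (m + 1)) (Fin (m + 1)) R :=
      of fun i j => if (j : ℕ) ≤ i + 1 then coeff (i + 1 - j : ℕ) f else 0 with hA
    have hconv (k : ℕ) :
        ∑ j ∈ Finset.range (k + 2), coeff (k + 1 - j) f * coeff j g = 0 := by
      have h := congrArg (coeff (k + 1)) hfg
      rw [mul_comm, coeff_mul, Finset.Nat.sum_antidiagonal_eq_sum_range_succ_mk, coeff_one,
        if_neg k.succ_ne_zero] at h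
      simpa only [mul_comm] using h
    have hmul : A *ᵥ (fun j => coeff (j : ℕ) g) =
        Pi.single (Fin.last m) (-coeff (m + 1) g) := by
      ext i
      have hsum : (A *ᵥ fun j => coeff (j : ℕ) g) i = ∑ j ∈ Finset.range (m + 1),
          if j ≤ (i : ℕ) + 1 then coeff (i + 1 - j : ℕ) f * coeff j g else 0 := by
        rw [← Fin.sum_univ_eq_sum_range (fun j =>
          if j ≤ (i : ℕ) + 1 then coeff (i + 1 - j : ℕ) f * coeff j g else 0)]
        simp [mulVec, dotProduct, hA, ite_mul]
      rw [hsum, ← Finset.sum_filter]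
      rcases Fin.eq_castSucc_or_eq_last i with ⟨k, rfl⟩ | rfl
      · rw [Pi.single_eq_of_ne (Fin.castSucc_lt_last k).ne, ← hconv k]
        refine Finset.sum_congr ?_ fun _ _ => rfl
        ext j
        have := k.isLt
        simp only [Finset.mem_filter, Finset.mem_range, Fin.val_castSucc]
        omega
      · rw [Pi.single_eq_same, eq_neg_iff_add_eq_zero, ← hconv m, Finset.sum_range_succ _ (m + 1),
          Nat.sub_self, hf, one_mul]
        congr 1
        refine Finset.sum_congr ?_ fun _ _ => rfl
        ext j
        simp only [Finset.mem_filter, Finset.mem_range, Fin.val_last]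
        omega
    have hminor : det (A.submatrix (Fin.last m).succAbove Fin.succ) = 1 := by
      rw [det_of_isLowerTriangular]
      · simp [-coeff_zero_eq_constantCoeff, hA, hf]
      · intro i j hij
        have : (i : ℕ) < j := hij
        simp [hA, Fin.lt_def.mpr this]
    have hcramer : A.cramer (A *ᵥ fun j => coeff (j : ℕ) g) 0 = A.det := by
      rw [cramer_eq_adjugate_mulVec, mulVec_mulVec, adjugate_mul, smul_mulVec, one_mulVec]
      simp [-coeff_zero_eq_constantCoeff, hg]
    rw [← hcramer, hmul, cramer_apply, det_succ_column_zero,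
      Finset.sum_eq_single (Fin.last m)]
    · have hsub : (A.updateCol 0 (Pi.single (Fin.last m) (-coeff (m + 1) g))).submatrix
          (Fin.last m).succAbove Fin.succ = A.submatrix (Fin.last m).succAbove Fin.succ := by
        ext i j
        simp
      rw [hsub, hminor]
      simp [pow_succ]
    · intro i _ hi
      simp [hi]
    · simp

theorem risingFactorial_mul_add (x n : ℕ) :
    risingFactorial x n * (x + n) = x * risingFactorial (x + 1) n := by
  have h := Finset.prod_range_succ (fun i => x + i) n
  rw [Finset.prod_range_succ'] at h
  rw [risingFactorial, ← h, add_zero, mul_comm, risingFactorial]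
  simp only [add_assoc, add_comm 1]

theorem risingFactorial_pos {x : ℕ} (hx : 0 < x) (n : ℕ) : 0 < risingFactorial x n :=
  Finset.prod_pos fun _ _ => by omega

/-- Determinant expression for the generalized hypergeometric Cauchy numbers,
defined by `1/₂F₁(M, N; N+1; -t) = Σ_{n≥0} c_{M,N,n} t^n/n!`. -/
theorem hypergeometric_cauchy_det (M N : ℕ) (hM : 1 ≤ M) (hN : 1 ≤ N)
    (c : ℕ → ℚ)
    (hc : (PowerSeries.mk fun n =>
        (-1 : ℚ) ^ n * (risingFactorial M n : ℚ) * (risingFactorial N n : ℚ) /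
          ((risingFactorial (N + 1) n : ℚ) * (n.factorial : ℚ)))⁻¹ =
      PowerSeries.mk fun n => c n / (n.factorial : ℚ))
    (n : ℕ) (hn : 1 ≤ n) :
    c n = (n.factorial : ℚ) *
      Matrix.det (Matrix.of fun i j : Fin n =>
        if (j : ℕ) ≤ (i : ℕ) then
          (risingFactorial M ((i : ℕ) - (j : ℕ) + 1) : ℚ) * (N : ℚ) /
            ((((i : ℕ) - (j : ℕ) + 1).factorial : ℚ) * ((N + ((i : ℕ) - (j : ℕ) + 1) : ℕ) : ℚ))
        else if (j : ℕ) = (i : ℕ) + 1 then 1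
        else 0) := by
  have hN0 : (N : ℚ) ≠ 0 := by positivity
  have hratio (k : ℕ) : (risingFactorial N k : ℚ) / risingFactorial (N + 1) k = N / (N + k) := by
    have hpos : (0 : ℚ) < risingFactorial (N + 1) k :=
      mod_cast risingFactorial_pos N.succ_pos k
    rw [div_eq_div_iff hpos.ne' (by positivity)]
    exact_mod_cast risingFactorial_mul_add N k
  set a : ℕ → ℚ := fun k => risingFactorial M k * N / (k.factorial * (N + k : ℕ)) with ha
  have ha0 : a 0 = 1 := by simp [ha, risingFactorial, hN0]
  have hF : (PowerSeries.mk fun n =>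
      (-1 : ℚ) ^ n * (risingFactorial M n : ℚ) * (risingFactorial N n : ℚ) /
        ((risingFactorial (N + 1) n : ℚ) * (n.factorial : ℚ))) =
      PowerSeries.rescale (-1) (PowerSeries.mk a) := by
    ext k
    simp only [PowerSeries.coeff_mk, PowerSeries.coeff_rescale, ha]
    rw [mul_comm (risingFactorial (N + 1) k : ℚ), mul_div_mul_comm, hratio, Nat.cast_add,
      div_mul_div_comm, mul_assoc, mul_div_assoc]
  have hmul : PowerSeries.mk a *
      PowerSeries.rescale (-1) (PowerSeries.mk fun n => c n / (n.factorial : ℚ)) = 1 := by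
    have h := PowerSeries.mul_inv_cancel (PowerSeries.rescale (-1) (PowerSeries.mk a))
      (by simp [← PowerSeries.coeff_zero_eq_constantCoeff_apply, PowerSeries.coeff_rescale, ha0])
    rw [← hF, hc, hF] at h
    simpa [PowerSeries.rescale_rescale] using congrArg (PowerSeries.rescale (-1)) h
  have hdet := PowerSeries.det_coeff_hessenberg (by simpa using ha0) hmul n
  rw [PowerSeries.coeff_rescale, PowerSeries.coeff_mk, ← mul_assoc, ← mul_pow, neg_one_mul,
    neg_neg, one_pow, one_mul] at hdet
  rw [eq_comm, mul_comm, ← eq_div_iff (by positivity), ← hdet]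
  congr 1
  ext i j
  simp only [Matrix.of_apply, PowerSeries.coeff_mk]
  rcases lt_trichotomy (j : ℕ) (i + 1) with h | h | h
  · rw [if_pos (by omega), if_pos h.le, Nat.sub_add_comm (by omega)]
  · rw [if_neg (by omega), if_pos h, if_pos h.le, h, Nat.sub_self, ha0]
  · rw [if_neg (by omega), if_neg (by omega), if_neg (by omega)]
end
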